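/- Let 0 < θ < π/2 and let a, b ∈ ℂ² be unit vectors such that |⟨ψ_S(θ), a⊗b⟩|² = cos²(θ/2) (i.e., the product fidelity with ψ_S(θ) is maximal). Then a⊗b = c·(e₀⊗e₀) for some complex number c with |c| = 1. Symmetrically, if π/2 < θ < π and |⟨ψ_S(θ), a⊗b⟩|² = sin²(θ/2), then a⊗b = c·(e₁⊗e₁) for some complex c with |c| = 1. -/

import Mathlib

open Matrix Real

noncomputable section

/-- Standard basis vectors of ℂ². -/
def e0 : Fin 2 → ℂ := ![1, 0]
def e1 : Fin 2 → ℂ := ![0, 1]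

/-- First-qubit index of a two-qubit basis label, with basis order
`(e₀⊗e₀, e₀⊗e₁, e₁⊗e₀, e₁⊗e₁)`. -/
def q1 : Fin 4 → Fin 2 := ![0, 0, 1, 1]
/-- Second-qubit index of a two-qubit basis label. -/
def q2 : Fin 4 → Fin 2 := ![0, 1, 0, 1]

/-- Kronecker (tensor) product of two vectors in ℂ², as a vector in ℂ⁴. -/
def vkron (a b : Fin 2 → ℂ) : Fin 4 → ℂ := fun i => a (q1 i) * b (q2 i)

/-- Kronecker product of two 2×2 matrices, as a 4×4 matrix in the basis
`(e₀⊗e₀, e₀⊗e₁, e₁⊗e₀, e₁⊗e₁)`. -/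
def mkron (A B : Matrix (Fin 2) (Fin 2) ℂ) : Matrix (Fin 4) (Fin 4) ℂ :=
  Matrix.of fun i j => A (q1 i) (q1 j) * B (q2 i) (q2 j)

/-- The outer product `|v⟩⟨v|`. -/
def outer (v : Fin 4 → ℂ) : Matrix (Fin 4) (Fin 4) ℂ :=
  Matrix.of fun i j => v i * star (v j)

/-- The two-qubit Schmidt state `ψ_S(θ) = cos(θ/2)·e₀⊗e₀ + sin(θ/2)·e₁⊗e₁`. -/
def psiS (θ : ℝ) : Fin 4 → ℂ :=
  (Real.cos (θ / 2) : ℂ) • vkron e0 e0 + (Real.sin (θ / 2) : ℂ) • vkron e1 e1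

/-- The Schmidt density matrix `ρ_S(θ) = |ψ_S(θ)⟩⟨ψ_S(θ)|`. -/
def rhoS (θ : ℝ) : Matrix (Fin 4) (Fin 4) ℂ := outer (psiS θ)

/-- σ₀, the 2×2 identity. -/
def σ₀ : Matrix (Fin 2) (Fin 2) ℂ := 1
/-- The Pauli matrices σ₁, σ₂, σ₃. -/
def pauli : Fin 3 → Matrix (Fin 2) (Fin 2) ℂ :=
  ![!![0, 1; 1, 0], !![0, -Complex.I; Complex.I, 0], !![1, 0; 0, -1]]

/-- The projector `P` onto the local (single-qubit) part:
`P(X) = (1/4)·Σ_{j=1}^{3} [Tr(X·(σ₀⊗σ_j))·(σ₀⊗σ_j) + Tr(X·(σ_j⊗σ₀))·(σ_j⊗σ₀)]`. -/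
def Pproj (X : Matrix (Fin 4) (Fin 4) ℂ) : Matrix (Fin 4) (Fin 4) ℂ :=
  (1 / 4 : ℂ) • ∑ j : Fin 3,
    ((X * mkron σ₀ (pauli j)).trace • mkron σ₀ (pauli j)
      + (X * mkron (pauli j) σ₀).trace • mkron (pauli j) σ₀)

/-- The matrix commutator. -/
def matComm (X Y : Matrix (Fin 4) (Fin 4) ℂ) : Matrix (Fin 4) (Fin 4) ℂ := X * Y - Y * X

/-- `a ∈ ℂ²` is a unit vector. -/
def unit2 (a : Fin 2 → ℂ) : Prop := ‖a 0‖ ^ 2 + ‖a 1‖ ^ 2 = 1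

/-- The inner product `⟨ψ, v⟩` on ℂ⁴ (conjugate-linear in the first slot). -/
def cinner (ψ v : Fin 4 → ℂ) : ℂ := ∑ i, starRingEnd ℂ (ψ i) * v i

theorem key_aux (C S : ℝ) (hS : 0 ≤ S) (hCS : S < C) (x y z w : ℂ)
    (hx : ‖x‖ ^ 2 + ‖y‖ ^ 2 = 1) (hz : ‖z‖ ^ 2 + ‖w‖ ^ 2 = 1)
    (h : ‖(C : ℂ) * (x * z) + (S : ℂ) * (y * w)‖ ^ 2 = C ^ 2) :
    y = 0 ∧ w = 0 ∧ ‖x * z‖ = 1 := by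
  have hC : 0 ≤ C := hS.trans hCS.le
  have h1 : ‖(C : ℂ) * (x * z) + (S : ℂ) * (y * w)‖ = C :=
    (pow_left_inj₀ (norm_nonneg _) hC two_ne_zero).1 h
  have h2 := norm_add_le ((C : ℂ) * (x * z)) ((S : ℂ) * (y * w))
  rw [h1] at h2
  simp only [norm_mul, Complex.norm_real, Real.norm_eq_abs, abs_of_nonneg hC,
    abs_of_nonneg hS] at h2
  have h3 : (C - S) * (‖y‖ ^ 2 + ‖w‖ ^ 2) ≤ 0 := by
    nlinarith [mul_nonneg hC (sq_nonneg (‖x‖ - ‖z‖)), mul_nonneg hS (sq_nonneg (‖y‖ - ‖w‖))]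
  have h4 : ‖y‖ ^ 2 + ‖w‖ ^ 2 ≤ 0 := by
    by_contra hc
    push Not at hc
    have := mul_pos (sub_pos.2 hCS) hc
    linarith
  have hy : ‖y‖ = 0 := by nlinarith [sq_nonneg ‖y‖, sq_nonneg ‖w‖]
  have hw : ‖w‖ = 0 := by nlinarith [sq_nonneg ‖y‖, sq_nonneg ‖w‖]
  rw [hy] at hx
  rw [hw] at hz
  have hx1 : ‖x‖ = 1 := by nlinarith [norm_nonneg x]
  have hz1 : ‖z‖ = 1 := by nlinarith [norm_nonneg z]
  exact ⟨norm_eq_zero.1 hy, norm_eq_zero.1 hw, by rw [norm_mul, hx1, hz1, one_mul]⟩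

theorem cinner_aux (θ : ℝ) (a b : Fin 2 → ℂ) :
    cinner (psiS θ) (vkron a b) =
      (Real.cos (θ / 2) : ℂ) * (a 0 * b 0) + (Real.sin (θ / 2) : ℂ) * (a 1 * b 1) := by
  simp [cinner, psiS, vkron, e0, e1, q1, q2, Fin.sum_univ_four, -Complex.ofReal_cos,
    -Complex.ofReal_sin]

/-- if unit vectors `a, b` achieve the maximal product fidelity with
`ψ_S(θ)`, then `a⊗b` is a unimodular multiple of `e₀⊗e₀` (for `0 < θ < π/2`),
respectively of `e₁⊗e₁` (for `π/2 < θ < π`). -/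
theorem maximizers_of_product_fidelity (θ : ℝ) (a b : Fin 2 → ℂ)
    (ha : unit2 a) (hb : unit2 b) :
    (0 < θ → θ < π / 2 →
      ‖cinner (psiS θ) (vkron a b)‖ ^ 2 = Real.cos (θ / 2) ^ 2 →
      ∃ c : ℂ, ‖c‖ = 1 ∧ vkron a b = c • vkron e0 e0) ∧
    (π / 2 < θ → θ < π →
      ‖cinner (psiS θ) (vkron a b)‖ ^ 2 = Real.sin (θ / 2) ^ 2 →
      ∃ c : ℂ, ‖c‖ = 1 ∧ vkron a b = c • vkron e1 e1) := by
  constructor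
  · intro h0 h1 h
    rw [cinner_aux] at h
    have hS : 0 ≤ Real.sin (θ / 2) := Real.sin_nonneg_of_nonneg_of_le_pi (by linarith) (by linarith)
    have hlt : Real.sin (θ / 2) < Real.cos (θ / 2) := by
      rw [← Real.sin_pi_div_two_sub]
      exact Real.sin_lt_sin_of_lt_of_le_pi_div_two (by linarith) (by linarith) (by linarith)
    obtain ⟨hy, hw, hn⟩ := key_aux _ _ hS hlt _ _ _ _ ha hb h
    refine ⟨a 0 * b 0, hn, ?_⟩
    ext i
    fin_cases i <;> simp [vkron, e0, q1, q2, hy, hw]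
  · intro h0 h1 h
    rw [cinner_aux, add_comm] at h
    have hC : 0 ≤ Real.cos (θ / 2) := Real.cos_nonneg_of_mem_Icc ⟨by linarith, by linarith⟩
    have hlt : Real.cos (θ / 2) < Real.sin (θ / 2) := by
      rw [← Real.sin_pi_div_two_sub]
      exact Real.sin_lt_sin_of_lt_of_le_pi_div_two (by linarith) (by linarith) (by linarith)
    obtain ⟨hy, hw, hn⟩ := key_aux _ _ hC hlt _ _ _ _
      ((add_comm _ _).trans ha) ((add_comm _ _).trans hb) h
    refine ⟨a 1 * b 1, hn, ?_⟩
    ext i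
    fin_cases i <;> simp [vkron, e1, q1, q2, hy, hw]
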